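/- Let ℳ be the explicit 21×21 nonnegative integer matrix of the paper. Then ℳ cannot be written as a sum of 19 rank-one matrices with nonnegative rational entries; that is, rank_{ℚ+} ℳ ≥ 20. -/

import Mathlib

/-- `A` is a sum of `k` rank-one matrices with nonnegative rational entries. -/
def NNDecompQ {m n : Type*} (A : Matrix m n ℚ) (k : ℕ) : Prop :=
  ∃ u : Fin k → m → ℚ, ∃ v : Fin k → n → ℚ,
    (∀ l i, 0 ≤ u l i) ∧ (∀ l j, 0 ≤ v l j) ∧
    A = ∑ l, Matrix.vecMulVec (u l) (v l)

/-- The nonnegative rank of a rational matrix `A` with respect to `ℚ`. -/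
noncomputable def nnRankQ {m n : Type*} (A : Matrix m n ℚ) : ℕ :=
  sInf {k | NNDecompQ A k}

/-- The explicit 21 × 21 matrix ℳ of the paper. -/
def Mcal (K : Type*) [Zero K] [One K] [OfNat K 2] : Matrix (Fin 21) (Fin 21) K :=
  Matrix.of
    ![![2,2,2,1,0,0,0,0,0,0,0,0,0,0,0,0,0,1,1,1,1],
      ![1,2,1,0,1,0,0,0,0,0,0,0,0,0,0,0,0,0,0,0,0],
      ![0,0,1,2,0,0,0,0,0,0,0,0,0,1,1,1,1,0,0,0,0],
      ![0,1,0,0,2,0,0,0,0,1,1,1,1,0,0,0,0,0,0,0,0],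
      ![0,1,1,2,2,1,1,1,1,0,0,0,0,0,0,0,0,0,0,0,0],
      ![0,0,0,1,1,1,1,0,0,0,0,0,0,0,0,0,0,0,0,0,0],
      ![0,0,0,0,0,0,1,1,0,0,0,0,0,0,0,0,0,0,0,0,0],
      ![0,0,0,0,0,0,0,1,1,0,0,0,0,0,0,0,0,0,0,0,0],
      ![0,0,0,0,0,1,0,0,1,0,0,0,0,0,0,0,0,0,0,0,0],
      ![0,0,0,0,1,0,0,0,0,1,1,0,0,0,0,0,0,0,0,0,0],
      ![0,0,0,0,0,0,0,0,0,0,1,1,0,0,0,0,0,0,0,0,0],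
      ![0,0,0,0,0,0,0,0,0,0,0,1,1,0,0,0,0,0,0,0,0],
      ![0,0,0,0,0,0,0,0,0,1,0,0,1,0,0,0,0,0,0,0,0],
      ![0,0,0,1,0,0,0,0,0,0,0,0,0,1,1,0,0,0,0,0,0],
      ![0,0,0,0,0,0,0,0,0,0,0,0,0,0,1,1,0,0,0,0,0],
      ![0,0,0,0,0,0,0,0,0,0,0,0,0,0,0,1,1,0,0,0,0],
      ![0,0,0,0,0,0,0,0,0,0,0,0,0,1,0,0,1,0,0,0,0],
      ![1,0,0,0,0,0,0,0,0,0,0,0,0,0,0,0,0,1,1,0,0],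
      ![0,0,0,0,0,0,0,0,0,0,0,0,0,0,0,0,0,0,1,1,0],
      ![0,0,0,0,0,0,0,0,0,0,0,0,0,0,0,0,0,0,0,1,1],
      ![0,0,0,0,0,0,0,0,0,0,0,0,0,0,0,0,0,1,0,0,1]]

/-- Index of the `k`-th row (column) meeting the cyclic blocks. -/
def blk (k : Fin 16) : Fin 21 := ⟨k.1 + 5, by omega⟩

lemma exists_dep {ι : Type*} [Fintype ι] (hc : Fintype.card ι ≤ 3)
    (u v : ι → Fin 21 → ℚ) (r : Fin 4 → Fin 21) :
    ∃ c : Fin 4 → ℚ, c ≠ 0 ∧ ∀ j, ∑ a, c a * (∑ l, u l (r a) * v l j) = 0 := by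
  classical
  let L : (Fin 4 → ℚ) →ₗ[ℚ] (ι → ℚ) := Matrix.toLin' (Matrix.of fun l a => u l (r a))
  have hL : LinearMap.ker L ≠ ⊥ := by
    apply LinearMap.ker_ne_bot_of_finrank_lt
    simp only [Module.finrank_fintype_fun_eq_card, Fintype.card_fin]
    omega
  obtain ⟨c, hcL, hc0⟩ := Submodule.exists_mem_ne_zero_of_ne_bot hL
  refine ⟨c, hc0, fun j => ?_⟩
  have h : ∀ l, ∑ a, u l (r a) * c a = 0 := fun l => congrFun (LinearMap.mem_ker.mp hcL) l
  simp_rw [Finset.mul_sum]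
  rw [Finset.sum_comm]
  apply Finset.sum_eq_zero
  intro l _
  have : ∑ a, c a * (u l (r a) * v l j) = (∑ a, u l (r a) * c a) * v l j := by
    rw [Finset.sum_mul]
    exact Finset.sum_congr rfl fun a _ => by ring
  rw [this, h, zero_mul]

lemma hnum (i j : Fin 21) : (Mcal ℚ i j).num = ((Mcal ℕ i j : ℕ) : ℚ).num := by
  revert i j
  decide +kernel

lemma hden (i j : Fin 21) : (Mcal ℚ i j).den = ((Mcal ℕ i j : ℕ) : ℚ).den := by
  revert i j
  decide +kernel

lemma Mcal_cast (i j : Fin 21) : Mcal ℚ i j = (Mcal ℕ i j : ℚ) := by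
  have h : ∀ i j : Fin 21, @Eq ℚ (Mcal ℚ i j) ((Mcal ℕ i j : ℕ) : ℚ) := fun i j =>
    Rat.ext (hnum i j) (hden i j)
  exact h i j

lemma algebra_part (R : Fin 21 → Fin 21 → ℚ) (p q : Fin 21 → ℚ) (hu5 : p 5 ≠ 0)
    (hdep : ∀ r : Fin 4 → Fin 21, ∃ c : Fin 4 → ℚ, c ≠ 0 ∧ ∀ j, ∑ a, c a * R (r a) j = 0)
    (r01 : R 0 1 = 2)
    (r02 : R 0 2 = 2)
    (r03 : R 0 3 = 1)
    (r04 : R 0 4 = 0)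
    (r10 : R 1 0 = 1)
    (r11 : R 1 1 = 2)
    (r12 : R 1 2 = 1)
    (r13 : R 1 3 = 0)
    (r14 : R 1 4 = 1)
    (r20 : R 2 0 = 0)
    (r21 : R 2 1 = 0)
    (r22 : R 2 2 = 1)
    (r24 : R 2 4 = 0)
    (r30 : R 3 0 = 0)
    (r31 : R 3 1 = 1)
    (r32 : R 3 2 = 0)
    (r33 : R 3 3 = 0)
    (r40 : R 4 0 = 0)
    (r41 : R 4 1 = 1)
    (r42 : R 4 2 = 1)
    (r43 : R 4 3 = 2 - p 4 * q 3)
    (r44 : R 4 4 = 2 - p 4 * q 4)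
    (r50 : R 5 0 = 0)
    (r51 : R 5 1 = 0)
    (r52 : R 5 2 = 0)
    (r53 : R 5 3 = 1 - p 5 * q 3)
    (r54 : R 5 4 = 1 - p 5 * q 4) : False := by
  -- row 5 of the remainder vanishes
  have h5 : R 5 3 = 0 ∧ R 5 4 = 0 := by
    obtain ⟨c, hc0, hc⟩ := hdep ![1, 2, 3, 5]
    have e0 := hc 0
    have e1 := hc 1
    have e2 := hc 2
    have e3 := hc 3
    have e4 := hc 4
    simp only [Fin.sum_univ_four, Matrix.cons_val] at e0 e1 e2 e3 e4
    rw [r10, r20, r30, r50] at e0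
    rw [r11, r21, r31, r51] at e1
    rw [r12, r22, r32, r52] at e2
    have c0 : c 0 = 0 := by linarith
    have c2 : c 2 = 0 := by linarith
    have c1 : c 1 = 0 := by linarith
    have c3 : c 3 ≠ 0 := by
      intro c3
      apply hc0
      ext a
      fin_cases a <;> simp [c0, c1, c2, c3]
    rw [c0, c1, c2] at e3 e4
    constructor
    · refine (mul_eq_zero.1 (?_ : c 3 * R 5 3 = 0)).resolve_left c3
      linarith
    · refine (mul_eq_zero.1 (?_ : c 3 * R 5 4 = 0)).resolve_left c3
      linarith
  have hv34 : q 3 = q 4 := by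
    have h1 : p 5 * (q 3 - q 4) = 0 := by linarith [h5.1, h5.2]
    have h2 := (mul_eq_zero.1 h1).resolve_left hu5
    linarith
  have h4 : R 4 3 = R 4 4 := by rw [r43, r44, hv34]
  have h4' : R 4 3 = R 2 3 ∧ R 4 4 = R 3 4 := by
    obtain ⟨c, hc0, hc⟩ := hdep ![1, 2, 3, 4]
    have e0 := hc 0
    have e1 := hc 1
    have e2 := hc 2
    have e3 := hc 3
    have e4 := hc 4
    simp only [Fin.sum_univ_four, Matrix.cons_val] at e0 e1 e2 e3 e4
    rw [r10, r20, r30, r40] at e0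
    rw [r11, r21, r31, r41] at e1
    rw [r12, r22, r32, r42] at e2
    rw [r13, r33] at e3
    rw [r14, r24] at e4
    have c0 : c 0 = 0 := by linarith
    have c2 : c 2 = -c 3 := by linarith
    have c1 : c 1 = -c 3 := by linarith
    have c3 : c 3 ≠ 0 := by
      intro c3
      apply hc0
      ext a
      fin_cases a <;> simp [c0, c1, c2, c3]
    rw [c0, c1, c2] at e3 e4
    constructor
    · apply mul_left_cancel₀ c3
      linarith
    · apply mul_left_cancel₀ c3
      linarith
  have h24 : R 3 4 = R 2 3 := by rw [← h4'.1, ← h4'.2, h4]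
  obtain ⟨c, hc0, hc⟩ := hdep ![1, 2, 3, 0]
  have e0 := hc 0
  have e1 := hc 1
  have e2 := hc 2
  have e3 := hc 3
  have e4 := hc 4
  simp only [Fin.sum_univ_four, Matrix.cons_val] at e0 e1 e2 e3 e4
  rw [r10, r20, r30] at e0
  rw [r11, r21, r31, r01] at e1
  rw [r12, r22, r32, r02] at e2
  rw [r13, r33, r03] at e3
  rw [r14, r24, r04, h24] at e4
  generalize R 0 0 = y at *
  generalize R 2 3 = x at *
  have c0 : c 0 = -(c 3 * y) := by linarith
  have c2 : c 2 = c 3 * (2 * y - 2) := by linarith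
  have c1 : c 1 = c 3 * (y - 2) := by linarith
  have c3 : c 3 ≠ 0 := by
    intro c3
    apply hc0
    ext a
    fin_cases a <;> simp [c0, c1, c2, c3]
  rw [c0, c1, c2] at e3 e4
  have x1 : (2 - y) * x = 1 := by
    apply mul_left_cancel₀ c3
    linarith
  have x2 : (2 * y - 2) * x = y := by
    apply mul_left_cancel₀ c3
    linarith
  have y2 : y * y = 2 := by
    linear_combination (2 - y) * x2 - (2 * y - 2) * x1
  have hirr := irrational_sqrt_two
  apply hirr
  refine ⟨|y|, ?_⟩
  rw [Rat.cast_abs, ← Real.sqrt_sq_eq_abs]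
  congr 1
  have : ((y * y : ℚ) : ℝ) = 2 := by rw [y2]; norm_num
  rw [sq]
  exact_mod_cast this


/-- Positions in the corner to which no chosen term contributes. -/
def okb (i j : Fin 21) : Bool :=
  decide (∀ k, Mcal ℕ i (blk k) = 0 ∨ Mcal ℕ (blk k) j = 0)

/-- Positions in the corner to which only the first chosen term contributes. -/
def okb1 (i j : Fin 21) : Bool :=
  decide (∀ k, k ≠ 0 → Mcal ℕ i (blk k) = 0 ∨ Mcal ℕ (blk k) j = 0)

lemma cov (i j : Fin 21) (h : okb i j = true) (k : Fin 16) :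
    Mcal ℕ i (blk k) = 0 ∨ Mcal ℕ (blk k) j = 0 := (of_decide_eq_true h) k

lemma cov1 (i j : Fin 21) (h : okb1 i j = true) (k : Fin 16) (hk : k ≠ 0) :
    Mcal ℕ i (blk k) = 0 ∨ Mcal ℕ (blk k) j = 0 := (of_decide_eq_true h) k hk

lemma diag_ne : ∀ k, Mcal ℕ (blk k) (blk k) ≠ 0 := by decide +kernel

lemma fooling : ∀ k k', k ≠ k' →
    Mcal ℕ (blk k) (blk k') = 0 ∨ Mcal ℕ (blk k') (blk k) = 0 := by decide +kernel

lemma val01 : Mcal ℕ 0 1 = 2 := rfl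
lemma val02 : Mcal ℕ 0 2 = 2 := rfl
lemma val03 : Mcal ℕ 0 3 = 1 := rfl
lemma val04 : Mcal ℕ 0 4 = 0 := rfl
lemma val10 : Mcal ℕ 1 0 = 1 := rfl
lemma val11 : Mcal ℕ 1 1 = 2 := rfl
lemma val12 : Mcal ℕ 1 2 = 1 := rfl
lemma val13 : Mcal ℕ 1 3 = 0 := rfl
lemma val14 : Mcal ℕ 1 4 = 1 := rfl
lemma val20 : Mcal ℕ 2 0 = 0 := rfl
lemma val21 : Mcal ℕ 2 1 = 0 := rfl
lemma val22 : Mcal ℕ 2 2 = 1 := rfl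
lemma val24 : Mcal ℕ 2 4 = 0 := rfl
lemma val30 : Mcal ℕ 3 0 = 0 := rfl
lemma val31 : Mcal ℕ 3 1 = 1 := rfl
lemma val32 : Mcal ℕ 3 2 = 0 := rfl
lemma val33 : Mcal ℕ 3 3 = 0 := rfl
lemma val40 : Mcal ℕ 4 0 = 0 := rfl
lemma val41 : Mcal ℕ 4 1 = 1 := rfl
lemma val42 : Mcal ℕ 4 2 = 1 := rfl
lemma val43 : Mcal ℕ 4 3 = 2 := rfl
lemma val44 : Mcal ℕ 4 4 = 2 := rfl
lemma val50 : Mcal ℕ 5 0 = 0 := rfl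
lemma val51 : Mcal ℕ 5 1 = 0 := rfl
lemma val52 : Mcal ℕ 5 2 = 0 := rfl
lemma val53 : Mcal ℕ 5 3 = 1 := rfl
lemma val54 : Mcal ℕ 5 4 = 1 := rfl

lemma no_decomp (n : ℕ) (hn : n ≤ 19) : ¬ NNDecompQ (Mcal ℚ) n := by
  classical
  rintro ⟨u, v, hu, hv, hM⟩
  have hE : ∀ i j, (Mcal ℕ i j : ℚ) = ∑ l, u l i * v l j := by
    intro i j
    rw [← Mcal_cast, hM, Matrix.sum_apply]
    rfl
  have hz : ∀ i j, Mcal ℕ i j = 0 → ∀ l, u l i * v l j = 0 := by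
    intro i j h l
    have h1 := hE i j
    rw [h, Nat.cast_zero] at h1
    exact (Finset.sum_eq_zero_iff_of_nonneg
      (fun l _ => mul_nonneg (hu l i) (hv l j))).1 h1.symm l (Finset.mem_univ l)
  have hex : ∀ k, ∃ l, u l (blk k) ≠ 0 ∧ v l (blk k) ≠ 0 := by
    intro k
    by_contra! hcon
    have h1 := hE (blk k) (blk k)
    rw [Finset.sum_eq_zero] at h1
    · exact diag_ne k (by exact_mod_cast h1)
    · intro l _
      by_cases h : u l (blk k) = 0
      · simp [h]
      · simp [hcon l h]
  choose f hfu hfv using hex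
  have hterm : ∀ i j k, (Mcal ℕ i (blk k) = 0 ∨ Mcal ℕ (blk k) j = 0) →
      u (f k) i * v (f k) j = 0 := by
    rintro i j k (h | h)
    · have := (mul_eq_zero.1 (hz _ _ h (f k))).resolve_right (hfv k)
      simp [this]
    · have := (mul_eq_zero.1 (hz _ _ h (f k))).resolve_left (hfu k)
      simp [this]
  have hinj : Function.Injective f := by
    intro k k' h
    by_contra hne
    rcases fooling k k' hne with h0 | h0
    · have := hz _ _ h0 (f k)
      exact mul_ne_zero (hfu k) (h ▸ hfv k') this
    · have := hz _ _ h0 (f k)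
      exact mul_ne_zero (h ▸ hfu k') (hfv k) this
  -- the remaining terms
  let T : Finset (Fin n) := (Finset.univ.image f)ᶜ
  have hT : Fintype.card T ≤ 3 := by
    rw [Fintype.card_coe, Finset.card_compl, Finset.card_image_of_injective _ hinj]
    simp
    omega
  let R : Fin 21 → Fin 21 → ℚ := fun i j => ∑ l : T, u l i * v l j
  let S : Fin 21 → Fin 21 → ℚ := fun i j => ∑ k, u (f k) i * v (f k) j
  have hRS : ∀ i j, R i j = (Mcal ℕ i j : ℚ) - S i j := by
    intro i j
    have h1 : R i j = ∑ l ∈ T, u l i * v l j :=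
      Finset.sum_coe_sort T (fun l => u l i * v l j)
    have h2 : S i j = ∑ l ∈ Finset.univ.image f, u l i * v l j :=
      (Finset.sum_image (f := fun l => u l i * v l j) (fun a _ b _ h => hinj h)).symm
    rw [hE, h1, h2, ← Finset.sum_add_sum_compl (Finset.univ.image f)]
    ring
  have hdep : ∀ r : Fin 4 → Fin 21, ∃ c : Fin 4 → ℚ, c ≠ 0 ∧ ∀ j, ∑ a, c a * R (r a) j = 0 :=
    fun r => exists_dep hT (fun l => u l) (fun l => v l) r
  have hS0 : ∀ i j, (∀ k, Mcal ℕ i (blk k) = 0 ∨ Mcal ℕ (blk k) j = 0) →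
      R i j = (Mcal ℕ i j : ℚ) := by
    intro i j h
    have : S i j = 0 := Finset.sum_eq_zero fun k _ => hterm i j k (h k)
    rw [hRS, this, sub_zero]
  have hS1 : ∀ i j, (∀ k, k ≠ 0 → Mcal ℕ i (blk k) = 0 ∨ Mcal ℕ (blk k) j = 0) →
      R i j = (Mcal ℕ i j : ℚ) - u (f 0) i * v (f 0) j := by
    intro i j h
    have : S i j = u (f 0) i * v (f 0) j :=
      Finset.sum_eq_single 0 (fun k _ hk => hterm i j k (h k hk)) (by simp)
    rw [hRS, this]
  clear_value R
  refine algebra_part R (u (f 0)) (v (f 0)) (hfu 0) hdep ?_ ?_ ?_ ?_ ?_ ?_ ?_ ?_ ?_ ?_ ?_ ?_ ?_ ?_ ?_ ?_ ?_ ?_ ?_ ?_ ?_ ?_ ?_ ?_ ?_ ?_ ?_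
  · rw [hS0 0 1 (cov 0 1 (by decide +kernel)), val01]; norm_num
  · rw [hS0 0 2 (cov 0 2 (by decide +kernel)), val02]; norm_num
  · rw [hS0 0 3 (cov 0 3 (by decide +kernel)), val03]; norm_num
  · rw [hS0 0 4 (cov 0 4 (by decide +kernel)), val04]; norm_num
  · rw [hS0 1 0 (cov 1 0 (by decide +kernel)), val10]; norm_num
  · rw [hS0 1 1 (cov 1 1 (by decide +kernel)), val11]; norm_num
  · rw [hS0 1 2 (cov 1 2 (by decide +kernel)), val12]; norm_num
  · rw [hS0 1 3 (cov 1 3 (by decide +kernel)), val13]; norm_num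
  · rw [hS0 1 4 (cov 1 4 (by decide +kernel)), val14]; norm_num
  · rw [hS0 2 0 (cov 2 0 (by decide +kernel)), val20]; norm_num
  · rw [hS0 2 1 (cov 2 1 (by decide +kernel)), val21]; norm_num
  · rw [hS0 2 2 (cov 2 2 (by decide +kernel)), val22]; norm_num
  · rw [hS0 2 4 (cov 2 4 (by decide +kernel)), val24]; norm_num
  · rw [hS0 3 0 (cov 3 0 (by decide +kernel)), val30]; norm_num
  · rw [hS0 3 1 (cov 3 1 (by decide +kernel)), val31]; norm_num
  · rw [hS0 3 2 (cov 3 2 (by decide +kernel)), val32]; norm_num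
  · rw [hS0 3 3 (cov 3 3 (by decide +kernel)), val33]; norm_num
  · rw [hS0 4 0 (cov 4 0 (by decide +kernel)), val40]; norm_num
  · rw [hS0 4 1 (cov 4 1 (by decide +kernel)), val41]; norm_num
  · rw [hS0 4 2 (cov 4 2 (by decide +kernel)), val42]; norm_num
  · rw [hS1 4 3 (cov1 4 3 (by decide +kernel)), val43]; norm_num
  · rw [hS1 4 4 (cov1 4 4 (by decide +kernel)), val44]; norm_num
  · rw [hS0 5 0 (cov 5 0 (by decide +kernel)), val50]; norm_num
  · rw [hS0 5 1 (cov 5 1 (by decide +kernel)), val51]; norm_num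
  · rw [hS0 5 2 (cov 5 2 (by decide +kernel)), val52]; norm_num
  · rw [hS1 5 3 (cov1 5 3 (by decide +kernel)), val53]; norm_num
  · rw [hS1 5 4 (cov1 5 4 (by decide +kernel)), val54]; norm_num

lemma decomp_exists : NNDecompQ (Mcal ℚ) 21 := by
  refine ⟨fun l i => if i = l then 1 else 0, fun l j => Mcal ℚ l j, ?_, ?_, ?_⟩
  · intro l i
    dsimp only
    split_ifs <;> norm_num
  · intro l j
    dsimp only
    rw [Mcal_cast]
    positivity
  · ext i j
    simp [Matrix.sum_apply, Matrix.vecMulVec_apply]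

theorem stmt12 :
    ¬ NNDecompQ (Mcal ℚ) 19 ∧ 20 ≤ nnRankQ (Mcal ℚ) := by
  refine ⟨no_decomp 19 le_rfl, le_csInf ⟨21, decomp_exists⟩ ?_⟩
  intro k hk
  by_contra h
  exact no_decomp k (by omega) hk
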